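/- Let Q be a group containing an infinite cyclic subgroup of finite index, and let A be a ℤQ-module which is finitely generated as an abelian group. Then the group cohomology H²(Q; A) is a finite group. -/

import Mathlib

open CategoryTheory groupCohomology Rep

/-- One-cocycles agreeing on a generating set are equal. -/
theorem vc_cocycle_ext {k G : Type} [CommRing k] [Group G] (M : Rep k G) (s : Set G)
    (hs : Subgroup.closure s = ⊤) (f f' : cocycles₁ M) (h : ∀ g ∈ s, f g = f' g) : f = f' := by
  apply cocycles₁_ext
  intro g
  have hg : g ∈ Subgroup.closure s := hs ▸ Subgroup.mem_top g
  induction hg using Subgroup.closure_induction with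
  | mem x hx => exact h x hx
  | one => simp
  | mul x y _ _ hx hy =>
    rw [(mem_cocycles₁_iff f).1 f.2, (mem_cocycles₁_iff f').1 f'.2, hx, hy]
  | inv x _ hx =>
    have h1 := cocycles₁_map_inv f x
    have h2 := cocycles₁_map_inv f' x
    have h3 := congrArg (M.ρ x⁻¹) (h1.trans ((congrArg Neg.neg hx).trans h2.symm))
    rwa [Representation.inv_self_apply, Representation.inv_self_apply] at h3

/-- On an infinite cyclic group a one-cocycle may have any value on the generator. -/
theorem vc_exists_cocycle {k G : Type} [CommRing k] [Group G] [Infinite G] (t : G)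
    (ht : ∀ g, g ∈ Subgroup.zpowers t) (M : Rep k G) (m : M) :
    ∃ f : cocycles₁ M, f t = m := by
  let φ : G →* MulAut (Multiplicative M) :=
    { toFun g :=
        { toFun x := .ofAdd (M.ρ g x.toAdd)
          invFun x := .ofAdd (M.ρ g⁻¹ x.toAdd)
          left_inv x := by simp
          right_inv x := by simp
          map_mul' x y := by simp }
      map_one' := by ext x; simp
      map_mul' x y := by ext x; simp }
  have hinj : Function.Injective fun n : ℤ => t ^ n := by
    rw [injective_zpow_iff_not_isOfFinOrder, ← orderOf_eq_zero_iff]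
    exact Infinite.orderOf_eq_zero_of_forall_mem_zpowers ht
  let e : Multiplicative ℤ ≃* G := MulEquiv.ofBijective (zpowersHom G t)
    ⟨fun a b hab => hinj hab, fun g => by
      obtain ⟨n, hn⟩ := ht g
      exact ⟨.ofAdd n, by simpa using hn⟩⟩
  have he : e.symm t = .ofAdd 1 := by
    rw [MulEquiv.symm_apply_eq]
    exact (zpow_one t).symm
  let x : Multiplicative M ⋊[φ] G := ⟨.ofAdd m, t⟩
  let F : G →* Multiplicative M ⋊[φ] G := (zpowersHom _ x).comp e.symm.toMonoidHom
  have hF : F t = x := by simp [F, he]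
  have hr : ∀ g, (F g).right = g := by
    intro g
    obtain ⟨n, rfl⟩ := ht g
    have : SemidirectProduct.rightHom (F (t ^ n)) = t ^ n := by
      rw [map_zpow, map_zpow, hF]; rfl
    exact this
  refine ⟨⟨fun g => (F g).left.toAdd, (mem_cocycles₁_iff _).2 fun g h => ?_⟩, ?_⟩
  · rw [map_mul, SemidirectProduct.mul_left, hr, add_comm]; rfl
  · change (F t).left.toAdd = m
    rw [hF]; rfl

/-- The unit `A ⟶ Coind Res A`. -/
noncomputable abbrev vcUnit {k G : Type} [CommRing k] [Group G] (S : Subgroup G) (A : Rep.{0} k G) :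
    A ⟶ Rep.coind S.subtype (res S.subtype A) :=
  resCoindToHom S.subtype A (res S.subtype A) (𝟙 _)

instance vcUnit_mono {k G : Type} [CommRing k] [Group G] (S : Subgroup G) (A : Rep.{0} k G) :
    Mono (vcUnit S A) := by
  rw [Rep.mono_iff_injective]
  intro x y hxy
  have := congrFun (congrArg Subtype.val hxy) 1
  simpa using! this

/-- The short complex `A ⟶ Coind Res A ⟶ N`. -/
noncomputable abbrev vcSeq {k G : Type} [CommRing k] [Group G] (S : Subgroup G) (A : Rep.{0} k G) :
    ShortComplex (Rep.{0} k G) :=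
  ShortComplex.mk (vcUnit S A) (Limits.cokernel.π (vcUnit S A)) (Limits.cokernel.condition _)

theorem vcSeq_exact {k G : Type} [CommRing k] [Group G] (S : Subgroup G) (A : Rep.{0} k G) :
    (vcSeq S A).ShortExact where
  exact := ShortComplex.exact_cokernel _
  mono_f := vcUnit_mono S A
  epi_g := by dsimp; infer_instance

theorem vc_isZero_coind {k G : Type} [CommRing k] [Group G] (S : Subgroup G) (A : Rep.{0} k G)
    (h : ∀ B : Rep.{0} k S, Limits.IsZero (groupCohomology B 2)) :
    Limits.IsZero (groupCohomology (vcSeq S A).X₂ 2) :=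
  (h _).of_iso (coindIso _ 2)

theorem vc_H1_map_surj {k G : Type} [CommRing k] [Group G] [Infinite G] (t : G)
    (ht : ∀ g, g ∈ Subgroup.zpowers t) {M N : Rep.{0} k G} (f : M ⟶ N) [Epi f] :
    Function.Surjective (map (MonoidHom.id G) f 1) := by
  intro z
  induction z using H1_induction_on with
  | h z =>
    obtain ⟨m, hm⟩ := (Rep.epi_iff_surjective f).1 inferInstance (z t)
    obtain ⟨y, hy⟩ := vc_exists_cocycle t ht M m
    refine ⟨H1π M y, ?_⟩
    have h1 := congr($(H1π_comp_map (MonoidHom.id G) f) y)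
    refine h1.trans ?_
    change H1π N (mapCocycles₁ (MonoidHom.id G) f y) = _
    congr 1
    apply vc_cocycle_ext N {t}
    · rw [← Subgroup.zpowers_eq_closure, eq_top_iff]; exact fun g _ => ht g
    · rintro g rfl
      rw [← hm, ← hy]
      exact congrFun (coe_mapCocycles₁ (MonoidHom.id G) f y) g

theorem vc_isZero_of_surj {k G : Type} [CommRing k] [Group G] {X : ShortComplex (Rep.{0} k G)}
    (hX : X.ShortExact) (hz : Limits.IsZero (groupCohomology X.X₂ 2))
    (hs : Function.Surjective (map (MonoidHom.id G) X.g 1)) :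
    Limits.IsZero (groupCohomology X.X₁ 2) := by
  have he : Epi (δ hX 1 2 rfl) := epi_δ_of_isZero hX 1 hz
  have h0 : map (MonoidHom.id G) X.g 1 ≫ δ hX 1 2 rfl = 0 :=
    (mapShortComplex₃ hX (i := 1) (j := 2) rfl).zero
  have : Epi (map (MonoidHom.id G) X.g 1) := (ModuleCat.epi_iff_surjective _).2 hs
  have h2 : δ hX 1 2 rfl = 0 := by
    rw [← cancel_epi (map (MonoidHom.id G) X.g 1), h0, Limits.comp_zero]
  exact Limits.IsZero.of_epi_eq_zero _ h2

theorem vc_isZero_H2 {k G : Type} [CommRing k] [Group G] [Infinite G] [IsCyclic G]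
    (A : Rep.{0} k G) : Limits.IsZero (groupCohomology A 2) := by
  obtain ⟨t, ht⟩ := IsCyclic.exists_generator (α := G)
  have hX := vcSeq_exact (⊥ : Subgroup G) A
  have hz := vc_isZero_coind (⊥ : Subgroup G) A
    fun B => isZero_groupCohomology_succ_of_subsingleton B 1
  have : Epi (vcSeq (⊥ : Subgroup G) A).g := hX.epi_g
  exact vc_isZero_of_surj hX hz (vc_H1_map_surj t ht _)

theorem vc_finite_H1 {k G : Type} [CommRing k] [IsNoetherianRing k] [Group G] (s : Set G) [Finite s]
    (hs : Subgroup.closure s = ⊤) (M : Rep.{0} k G) [Module.Finite k M] :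
    Module.Finite k (groupCohomology M 1) := by
  let L : cocycles₁ M →ₗ[k] (s → M) :=
    { toFun f g := f g
      map_add' _ _ := rfl
      map_smul' _ _ := rfl }
  have hL : Function.Injective L := fun f f' h =>
    vc_cocycle_ext M s hs f f' fun g hg => congrFun h ⟨g, hg⟩
  have : Module.Finite k (cocycles₁ M) := Module.Finite.of_injective L hL
  exact Module.Finite.of_surjective (H1π M).hom
    ((ModuleCat.epi_iff_surjective _).1 inferInstance)

theorem vc_finite_coind {k G : Type} [CommRing k] [IsNoetherianRing k] [Group G] (S : Subgroup G) [S.FiniteIndex]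
    (B : Rep.{0} k S) [Module.Finite k B] : Module.Finite k (Rep.coind S.subtype B) := by
  let L : Representation.coindV S.subtype B.ρ →ₗ[k] (G ⧸ S → B) :=
    { toFun f q := f.1 (q.out)⁻¹
      map_add' _ _ := rfl
      map_smul' _ _ := rfl }
  have : Finite (G ⧸ S) := Subgroup.finite_quotient_of_finiteIndex
  refine Module.Finite.of_injective L fun f f' h => Subtype.ext (funext fun g => ?_)
  have h1 : ((g⁻¹ : G) : G ⧸ S).out⁻¹ * g⁻¹ ∈ S := by
    rw [← QuotientGroup.eq]; simp
  have h2 := congrFun h ((g⁻¹ : G) : G ⧸ S)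
  change f.1 _ = f'.1 _ at h2
  have h3 : g = S.subtype (⟨_, h1⟩ : S)⁻¹ * ((g⁻¹ : G) : G ⧸ S).out⁻¹ := by
    simp [mul_assoc]
  rw [h3, f.2, f'.2, h2]

theorem vc_gen {G : Type} [Group G] (S : Subgroup G) [S.FiniteIndex] [IsCyclic S] :
    ∃ s : Set G, Finite s ∧ Subgroup.closure s = ⊤ := by
  obtain ⟨t, ht⟩ := IsCyclic.exists_generator (α := S)
  have : Finite (G ⧸ S) := Subgroup.finite_quotient_of_finiteIndex
  refine ⟨insert (t : G) (Set.range fun q : G ⧸ S => q.out),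
    ((Set.finite_range _).insert _).to_subtype, ?_⟩
  rw [eq_top_iff]
  intro g _
  have h1 : ((g : G) : G ⧸ S).out⁻¹ * g ∈ S := by
    rw [← QuotientGroup.eq]; simp
  obtain ⟨n, hn⟩ := ht ⟨_, h1⟩
  have hn' : (t : G) ^ n = ((g : G) : G ⧸ S).out⁻¹ * g := by
    simpa using congrArg Subtype.val hn
  have : g = ((g : G) : G ⧸ S).out * (t : G) ^ n := by rw [hn']; simp
  rw [this]
  refine mul_mem (Subgroup.subset_closure (Set.mem_insert_of_mem _ ⟨_, rfl⟩))
    (zpow_mem (Subgroup.subset_closure (Set.mem_insert _ _)) n)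

theorem vc_transfer {k G : Type} [CommRing k] [Group G] (S : Subgroup G) [S.FiniteIndex] (A : Rep.{0} k G) :
    ∃ (n : ℕ) (τ : Rep.coind S.subtype (res S.subtype A) ⟶ A), n ≠ 0 ∧
      ∀ a : A, (vcUnit S A ≫ τ).hom a = n • a := by
  classical
  let := Subgroup.fintypeQuotientOfFiniteIndex (H := S)
  have : Nonempty (_root_.Quotient (QuotientGroup.rightRel S)) := ⟨_root_.Quotient.mk _ 1⟩
  refine ⟨Fintype.card (_root_.Quotient (QuotientGroup.rightRel S)),
    (indCoindIso (res S.subtype A)).inv ≫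
    (indResHomEquiv S.subtype (res S.subtype A) A).symm (𝟙 _), Fintype.card_ne_zero, ?_⟩
  intro a
  change ((indResHomEquiv S.subtype (res S.subtype A) A).symm (𝟙 _)).hom
    (coindToInd (res S.subtype A) ((vcUnit S A).hom a)) = _
  rw [coindToInd_apply, map_sum]
  rw [Finset.sum_congr rfl (g := fun _ => a)]
  · rw [Finset.sum_const, Finset.card_univ]
  · intro q _
    induction q using Quotient.inductionOn with
    | h g =>
      simp

theorem vc_torsion {k G : Type} [CommRing k] [Group G] (S : Subgroup G) [S.FiniteIndex] (A : Rep.{0} k G)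
    (h : ∀ B : Rep.{0} k S, Limits.IsZero (groupCohomology B 2)) :
    ∃ n : ℕ, n ≠ 0 ∧ ∀ x : groupCohomology A 2, n • x = 0 := by
  obtain ⟨n, τ, hn, hτ⟩ := vc_transfer S A
  refine ⟨n, hn, fun x => ?_⟩
  have hz := vc_isZero_coind S A h
  have h0 : map (MonoidHom.id G) (vcUnit S A ≫ τ) 2 = 0 := by
    rw [map_id_comp, hz.eq_of_tgt (map (MonoidHom.id G) (vcUnit S A) 2) 0, Limits.zero_comp]
  induction x using H2_induction_on with
  | h x =>
    have h1 := congr($(H2π_comp_map (MonoidHom.id G) (vcUnit S A ≫ τ)) x)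
    rw [h0] at h1
    have h2 : mapCocycles₂ (MonoidHom.id G) (vcUnit S A ≫ τ) x = n • x := by
      apply cocycles₂_ext
      intro g g'
      refine (congrFun (coe_mapCocycles₂ (MonoidHom.id G) (vcUnit S A ≫ τ) x) (g, g')).trans ?_
      exact hτ (x (g, g'))
    rw [← map_nsmul, ← h2]
    exact h1.symm

theorem vc_finite_H2 {k G : Type} [CommRing k] [IsNoetherianRing k] [Group G]
    (C : Subgroup G) [IsCyclic C] [Infinite C] [C.FiniteIndex]
    (A : Rep.{0} k G) [hA : Module.Finite k A] : Module.Finite k (groupCohomology A 2) := by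
  have hX := vcSeq_exact C A
  have he : Epi (δ hX 1 2 rfl) := epi_δ_of_isZero hX 1 (vc_isZero_coind C A vc_isZero_H2)
  obtain ⟨s, hs, hs'⟩ := vc_gen C
  have : Module.Finite k (res C.subtype A) := hA
  have : Module.Finite k (vcSeq C A).X₂ := vc_finite_coind C _
  have : Module.Finite k (vcSeq C A).X₃ :=
    Module.Finite.of_surjective (vcSeq C A).g.hom.toLinearMap
      ((Rep.epi_iff_surjective _).1 hX.epi_g)
  have := vc_finite_H1 s hs' (vcSeq C A).X₃
  exact Module.Finite.of_surjective (δ hX 1 2 rfl).hom ((ModuleCat.epi_iff_surjective _).1 he)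

theorem finite_groupCohomology_two_of_virtually_cyclic
    (Q : Type) [Group Q]
    (hQ : ∃ C : Subgroup Q, IsCyclic C ∧ Infinite C ∧ C.FiniteIndex)
    (A : Type) [AddCommGroup A] [Module ℤ A] [Module.Finite ℤ A]
    (ρ : Representation ℤ Q A) :
    Finite (groupCohomology (Rep.of ρ) 2) := by
  obtain ⟨C, hC, hi, hf⟩ := hQ
  obtain ⟨n, hn, hn'⟩ := vc_torsion C (Rep.of ρ) vc_isZero_H2
  have hfin := @vc_finite_H2 ℤ Q _ _ _ C hC hi hf (Rep.of ρ) ‹Module.Finite ℤ A›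
  refine @Module.finite_of_fg_torsion _ _ _ hfin ?_
  intro x
  refine ⟨⟨(n : ℤ), mem_nonZeroDivisors_of_ne_zero (by exact_mod_cast hn)⟩, ?_⟩
  have := hn' x
  rw [← Nat.cast_smul_eq_nsmul ℤ] at this
  exact this
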